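/- A finite group G is autonilpotent if and only if, for every prime p and every p-subgroup P of G, the quotient N_{Aut G}(P)/C_{Aut G}(P) is a p-group, where N_{Aut G}(P) = {α ∈ Aut G : α(P) = P} and C_{Aut G}(P) = {α ∈ Aut G : α(x) = x for all x ∈ P}. -/

import Mathlib

open Pointwise

/-- The autocommutator `[x, α] = x⁻¹ · α(x)`. -/
def autoComm {G : Type*} [Group G] (x : G) (α : MulAut G) : G := x⁻¹ * α x

/-- `autoL G n = Lₙ(G)`: elements `x` with `[x, α₁, …, αₙ] = 1` for all `α₁, …, αₙ ∈ Aut G`. -/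
def autoL (G : Type*) [Group G] (n : ℕ) : Set G :=
  {x | ∀ l : List (MulAut G), l.length = n → l.foldl autoComm x = 1}

/-- A group is autonilpotent if `G = Lₙ(G)` for some `n`. -/
def Autonilpotent (G : Type*) [Group G] : Prop := ∃ n : ℕ, ∀ x : G, x ∈ autoL G n

/-- `N_{Aut G}(P)`: automorphisms `α` of `G` with `α(P) = P`. -/
def autN {G : Type*} [Group G] (P : Subgroup G) : Subgroup (MulAut G) :=
  MulAction.stabilizer (MulAut G) P

/-- `C_{Aut G}(P)`: automorphisms `α` of `G` with `α(x) = x` for all `x ∈ P`. -/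
def autC {G : Type*} [Group G] (P : Subgroup G) : Subgroup (MulAut G) :=
  ⨅ x ∈ (P : Set G), MulAction.stabilizer (MulAut G) x

/-- `C_{Aut G}(P)` is normal in `N_{Aut G}(P)`, so the quotient group exists. -/
instance autC_normal_in_autN {G : Type*} [Group G] (P : Subgroup G) :
    ((autC P).subgroupOf (autN P)).Normal := by
  constructor
  intro β hβ α
  simp only [Subgroup.mem_subgroupOf, autC, Subgroup.mem_iInf,
    MulAction.mem_stabilizer_iff] at hβ ⊢
  intro x hx
  have hα : (α : MulAut G) • P = P := α.2
  have hx' : (α : MulAut G)⁻¹ • x ∈ P := by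
    rw [← Subgroup.mem_pointwise_smul_iff_inv_smul_mem, hα]
    exact hx
  have hfix := hβ _ hx'
  push_cast
  rw [mul_smul, mul_smul, hfix, smul_inv_smul]

open Subgroup

/-- Frobenius' condition for inner automorphisms: elements normalizing a `p`-subgroup act on it
with `p`-power order. -/
def InnerFrobenius (G : Type*) [Group G] : Prop :=
  ∀ p : ℕ, p.Prime → ∀ P : Subgroup G, IsPGroup p P → ∀ g ∈ normalizer (P : Set G),
    ∃ k : ℕ, ∀ x ∈ P, Commute (g ^ p ^ k) x

lemma InnerFrobenius.subgroup {G : Type*} [Group G] (hG : InnerFrobenius G) (H : Subgroup G) :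
    InnerFrobenius H := by
  intro p hp P hP g hg
  obtain ⟨k, hk⟩ := hG p hp (P.map H.subtype) (hP.map _) g
    (le_normalizer_map H.subtype (mem_map_of_mem _ hg))
  refine ⟨k, fun x hx ↦ ?_⟩
  have := hk x (mem_map_of_mem H.subtype hx)
  exact Subtype.ext this.eq

lemma Subgroup.mem_of_pow_mem_of_coprime {G : Type*} [Group G] (H : Subgroup G) {m n : ℕ}
    (h : m.Coprime n) {g : G} (hm : g ^ m ∈ H) (hn : g ^ n ∈ H) : g ∈ H := by
  have hb := Nat.gcd_eq_gcd_ab m n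
  rw [h.gcd_eq_one] at hb
  have : g = (g ^ m) ^ m.gcdA n * (g ^ n) ^ m.gcdB n := by
    rw [← zpow_natCast, ← zpow_natCast, ← zpow_mul, ← zpow_mul, ← zpow_add, ← hb]
    simp
  rw [this]
  exact mul_mem (zpow_mem hm _) (zpow_mem hn _)

/-- An element normalizing a Sylow subgroup and acting on it with `p`-power order does not move
elements of the Sylow subgroup modulo its commutator subgroup. -/
lemma Sylow.map_eq_of_conj_of_mem_normalizer {G : Type*} [Group G] [Finite G]
    {p : ℕ} [hp : Fact p.Prime] (P : Sylow p G) {A : Type*} [CommGroup A]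
    (ϕ : (P : Subgroup G) →* A) {g : G} (hg : g ∈ normalizer ((P : Subgroup G) : Set G)) {k : ℕ}
    (hk : ∀ x ∈ P, Commute (g ^ p ^ k) x) (a b : (P : Subgroup G))
    (hab : g⁻¹ * a * g = b) : ϕ a = ϕ b := by
  let P' := P.subtype (N := normalizer ((P : Subgroup G) : Set G)) le_normalizer
  have hP' : P'.toSubgroup.Normal := by
    rw [Sylow.coe_subtype]
    exact normal_in_normalizer
  have hj : g ^ P'.toSubgroup.index ∈ P := by
    have := P'.toSubgroup.pow_index_mem ⟨g, hg⟩
    rwa [Sylow.coe_subtype, mem_subgroupOf] at this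
  have hcop : P'.toSubgroup.index.Coprime (p ^ k) :=
    (((Nat.Prime.coprime_iff_not_dvd hp.out).2 P'.not_dvd_index).symm).pow_right k
  set m := P'.toSubgroup.index
  have hb := Nat.gcd_eq_gcd_ab m (p ^ k)
  rw [hcop.gcd_eq_one] at hb
  let u : (P : Subgroup G) := ⟨g ^ m, hj⟩ ^ m.gcdA (p ^ k)
  set c : G := (g ^ p ^ k) ^ m.gcdB (p ^ k) with hc
  have hgu : g = u * c := by
    simp only [u, hc, coe_zpow]
    rw [← zpow_natCast, ← zpow_natCast g (p ^ k), ← zpow_mul, ← zpow_mul, ← zpow_add, ← hb]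
    simp
  have hcomm : Commute c ((u⁻¹ * a * u : (P : Subgroup G)) : G) :=
    (hk _ (u⁻¹ * a * u : (P : Subgroup G)).2).zpow_left _
  have : b = u⁻¹ * a * u := by
    apply Subtype.ext
    rw [← hab, hgu]
    have h2 := hcomm.eq
    push_cast at h2 ⊢
    calc ((u : G) * c)⁻¹ * a * (u * c) = c⁻¹ * ((u : G)⁻¹ * a * u * c) := by group
      _ = _ := by rw [← h2]; group
  rw [this]
  simp

/-- If conjugate elements of a nontrivial Sylow subgroup `P` agree modulo `P'`, then the group has
a proper normal subgroup of `p`-power index. -/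
lemma Sylow.exists_normal_of_fusion {G : Type*} [Group G] [Finite G] {p : ℕ} [hp : Fact p.Prime]
    (P : Sylow p G) (hP : (P : Subgroup G) ≠ ⊥)
    (h : ∀ (g : G) (a b : (P : Subgroup G)), g⁻¹ * a * g = b →
      Abelianization.of a = Abelianization.of b) :
    ∃ N : Subgroup G, N.Normal ∧ N ≠ ⊤ ∧ ∀ g : G, ∃ k : ℕ, g ^ p ^ k ∈ N := by
  classical
  have hpA : IsPGroup p (Abelianization (P : Subgroup G)) :=
    P.isPGroup'.of_surjective Abelianization.of (QuotientGroup.mk'_surjective _)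
  let τ : G →* Abelianization (P : Subgroup G) := MonoidHom.transfer Abelianization.of
  have hτ (a : (P : Subgroup G)) : τ a = Abelianization.of a ^ (P : Subgroup G).index := by
    let := (P : Subgroup G).fintypeQuotientOfFiniteIndex
    let := Fintype.ofFinite (Quotient (MulAction.orbitRel (zpowers (a : G)) (G ⧸ (P : Subgroup G))))
    rw [MonoidHom.transfer_eq_prod_quotient_orbitRel_zpowers_quot,
      index_eq_sum_minimalPeriod (P : Subgroup G) (a : G), ← Finset.prod_pow_eq_pow_sum]
    refine Finset.prod_congr rfl fun q _ ↦ ?_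
    rw [← map_pow]
    refine (h q.out.out _ _ ?_).symm
    simp
  refine ⟨τ.ker, inferInstance, fun htop ↦ ?_, fun g ↦ ?_⟩
  · have := (P : Subgroup G).nontrivial_iff_ne_bot.2 hP
    have : Group.IsNilpotent (P : Subgroup G) := P.isPGroup'.isNilpotent
    have hlt := Group.IsSolvable.commutator_lt_top_of_nontrivial (P : Subgroup G)
    obtain ⟨a, -, ha⟩ := SetLike.exists_of_lt hlt
    rw [← Abelianization.ker_of, MonoidHom.mem_ker] at ha
    have h1 : τ a = 1 := by rw [← MonoidHom.mem_ker, htop]; trivial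
    rw [hτ] at h1
    have hcop : p.Coprime (P : Subgroup G).index :=
      (Nat.Prime.coprime_iff_not_dvd hp.out).2 P.not_dvd_index
    exact ha ((hpA.powEquiv hcop).injective (by simpa using h1))
  · obtain ⟨k, hk⟩ := hpA.exists_pow_pow_eq_one (τ g)
    exact ⟨k, by rw [MonoidHom.mem_ker, map_pow, hk]⟩

/-- If all proper subgroups are nilpotent and all normal `p`-subgroups are central, then distinct
Sylow `p`-subgroups intersect in a central subgroup. -/
lemma Sylow.inf_le_center_of_ne {G : Type*} [Group G] [Finite G] {p : ℕ} [hp : Fact p.Prime]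
    (hnil : ∀ H : Subgroup G, H ≠ ⊤ → Group.IsNilpotent H)
    (hcen : ∀ V : Subgroup G, V.Normal → IsPGroup p V → V ≤ center G)
    (P Q : Sylow p G) (hPQ : P ≠ Q) : (P ⊓ Q : Subgroup G) ≤ center G := by
  by_contra hD
  obtain ⟨D, ⟨P, Q, hPQ, rfl, hD⟩, hmax⟩ := (Set.toFinite {D : Subgroup G | ∃ P Q : Sylow p G,
    P ≠ Q ∧ D = (P ⊓ Q : Subgroup G) ∧ ¬ D ≤ center G}).exists_maximal ⟨_, P, Q, hPQ, rfl, hD⟩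
  set D : Subgroup G := (P ⊓ Q : Subgroup G) with hDdef
  have hN : normalizer (D : Set G) ≠ ⊤ := fun h ↦
    hD (hcen D (normalizer_eq_top_iff.1 h) (P.isPGroup'.to_le inf_le_left))
  have := hnil _ hN
  obtain ⟨S⟩ : Nonempty (Sylow p (normalizer (D : Set G))) := inferInstance
  have hS : S.toSubgroup.Normal := inferInstance
  obtain ⟨R, hR⟩ := (S.isPGroup'.map (normalizer (D : Set G)).subtype).exists_le_sylow
  have hle (T : Sylow p G) : (T ⊓ normalizer (D : Set G) : Subgroup G) ≤ R := by
    refine le_trans ?_ hR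
    have hT : IsPGroup p ((T : Subgroup G).subgroupOf (normalizer (D : Set G))) :=
      T.isPGroup'.comap_subtype
    obtain ⟨S', hS'⟩ := hT.exists_le_sylow
    have := S.unique_of_normal hS
    rw [Subsingleton.elim S' S] at hS'
    rw [← subgroupOf_map_subtype]
    exact map_mono hS'
  have key (T : Sylow p G) (hDT : D < T) : T = R := by
    by_contra hTR
    have hlt : D < (T ⊓ normalizer (D : Set G) : Subgroup G) := by
      have : Group.IsNilpotent (T : Subgroup G) := T.isPGroup'.isNilpotent
      have h1 : D.subgroupOf T < ⊤ := lt_top_iff_ne_top.2 fun h ↦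
        hDT.not_ge (subgroupOf_eq_top.1 h)
      obtain ⟨x, hx, hxD⟩ := SetLike.exists_of_lt
        (Group.normalizerCondition_of_isNilpotent (D.subgroupOf T) h1)
      rw [← subgroupOf_normalizer_eq hDT.le] at hx
      exact lt_of_le_of_ne (le_inf hDT.le le_normalizer) fun h ↦
        hxD (mem_subgroupOf.2 (h ▸ mem_inf.2 ⟨x.2, hx⟩))
    have hlt' : D < (T ⊓ R : Subgroup G) := hlt.trans_le (le_inf inf_le_left (hle T))
    exact hlt'.not_ge (hmax ⟨T, R, hTR, rfl, fun h ↦ hD (hlt'.le.trans h)⟩ hlt'.le)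
  have hcard : Nat.card P = Nat.card Q := by
    rw [P.card_eq_multiplicity, Q.card_eq_multiplicity]
  refine hPQ ((key P (lt_of_le_of_ne inf_le_left fun h ↦ hPQ ?_)).trans
    (key Q (lt_of_le_of_ne inf_le_right fun h ↦ hPQ ?_)).symm)
  · exact Sylow.ext (eq_of_le_of_card_ge (inf_eq_left.1 h) hcard.ge)
  · exact Sylow.ext (eq_of_le_of_card_ge (inf_eq_right.1 h) hcard.le).symm

lemma InnerFrobenius.exists_normal {G : Type*} [Group G] [Finite G] (hG : InnerFrobenius G)
    (hnil : ∀ H : Subgroup G, H ≠ ⊤ → Group.IsNilpotent H) {p : ℕ} [hp : Fact p.Prime]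
    (hdvd : p ∣ Nat.card G) :
    ∃ N : Subgroup G, N.Normal ∧ N ≠ ⊤ ∧ ∀ g : G, ∃ k : ℕ, g ^ p ^ k ∈ N := by
  by_cases hcen : ∀ V : Subgroup G, V.Normal → IsPGroup p V → V ≤ center G
  · obtain ⟨P⟩ : Nonempty (Sylow p G) := inferInstance
    refine P.exists_normal_of_fusion (P.ne_bot_of_dvd_card hdvd) fun g a b hab ↦ ?_
    by_cases ha : (a : G) ∈ center G
    · rw [Subtype.ext (a1 := a) (a2 := b)]
      rw [← hab, mul_assoc, ← mem_center_iff.1 ha g]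
      simp
    · have hgP : g • P = P := by
        by_contra hne
        refine ha (Sylow.inf_le_center_of_ne hnil hcen _ _ hne (mem_inf.2 ⟨?_, a.2⟩))
        rw [Sylow.coe_subgroup_smul, mem_pointwise_smul_iff_inv_smul_mem, ← map_inv,
          MulAut.smul_def, MulAut.conj_apply, inv_inv, hab]
        exact b.2
      rw [Sylow.smul_eq_iff_mem_normalizer] at hgP
      obtain ⟨k, hk⟩ := hG p hp.out P P.isPGroup' g hgP
      exact P.map_eq_of_conj_of_mem_normalizer _ hgP hk a b hab
  · push Not at hcen
    obtain ⟨V, hV, hpV, hVc⟩ := hcen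
    refine ⟨centralizer V, inferInstance, fun h ↦ hVc (centralizer_eq_top_iff_subset.1 h),
      fun g ↦ ?_⟩
    obtain ⟨k, hk⟩ := hG p hp.out V hpV g (by rw [normalizer_eq_top_iff.2 hV]; trivial)
    exact ⟨k, mem_centralizer_iff.2 fun x hx ↦ (hk x hx).eq.symm⟩

lemma Sylow.normal_of_le_nilpotent_normal {G : Type*} [Group G] [Finite G] {q : ℕ}
    [hq : Fact q.Prime] (Q : Sylow q G) (N : Subgroup G) [N.Normal] [Group.IsNilpotent N]
    (hQN : (Q : Subgroup G) ≤ N) : (Q : Subgroup G).Normal := by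
  have h1 : ((Q.subtype hQN : Sylow q N) : Subgroup N).Normal := inferInstance
  have h2 := (Q.subtype hQN).characteristic_of_normal h1
  have h3 : (((Q.subtype hQN : Sylow q N) : Subgroup N).map N.subtype).Normal := inferInstance
  rwa [Sylow.coe_subtype, map_subgroupOf_eq_of_le hQN] at h3

theorem InnerFrobenius.isNilpotent {G : Type*} [Group G] [Finite G] (hG : InnerFrobenius G) :
    Group.IsNilpotent G := by
  induction hn : Nat.card G using Nat.strong_induction_on generalizing G with
  | _ n ih =>
  have hnil (H : Subgroup G) (hH : H ≠ ⊤) : Group.IsNilpotent H := by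
    refine ih _ ?_ (hG.subgroup H) rfl
    rw [← hn]
    exact lt_of_le_of_ne (card_le_card_group H) fun h ↦ hH (eq_top_of_card_eq H h)
  by_cases hp : ∃ p : ℕ, IsPGroup p G ∧ p.Prime
  · obtain ⟨p, hp, hpp⟩ := hp
    have := Fact.mk hpp
    exact hp.isNilpotent
  refine (Group.isNilpotent_of_finite_tfae.out 0 3 rfl rfl).2 fun q hq Q ↦ ?_
  have : ∃ p : ℕ, p.Prime ∧ p ∣ Nat.card G ∧ p ≠ q := by
    by_contra! h
    refine hp ⟨q, IsPGroup.of_card (n := (Nat.card G).primeFactorsList.length) ?_, hq.out⟩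
    exact Nat.eq_prime_pow_of_unique_prime_dvd Nat.card_pos.ne' fun hd hdvd ↦ h _ hd hdvd
  obtain ⟨p, hpp, hdvd, hpq⟩ := this
  have := Fact.mk hpp
  obtain ⟨N, hN, hNtop, hpow⟩ := hG.exists_normal hnil hdvd
  have := hnil N hNtop
  refine Q.normal_of_le_nilpotent_normal N fun g hg ↦ ?_
  obtain ⟨k, hk⟩ := hpow g
  obtain ⟨m, hm⟩ := Q.isPGroup'.exists_pow_pow_eq_one ⟨g, hg⟩
  refine N.mem_of_pow_mem_of_coprime (m := p ^ k) (n := q ^ m) ?_ hk ?_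
  · exact Nat.Coprime.pow _ _ ((Nat.coprime_primes hpp hq.out).2 hpq)
  · rw [Subtype.ext_iff] at hm
    simp only [coe_pow, coe_one] at hm
    rw [hm]
    exact one_mem N

lemma mem_autC {G : Type*} [Group G] {P : Subgroup G} {α : MulAut G} :
    α ∈ autC P ↔ ∀ x ∈ P, α x = x := by
  simp [autC, mem_iInf, MulAction.mem_stabilizer_iff]

lemma isPGroup_autN_quotient_autC_iff {G : Type*} [Group G] {p : ℕ} {P : Subgroup G} :
    IsPGroup p (↥(autN P) ⧸ (autC P).subgroupOf (autN P)) ↔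
      ∀ α ∈ autN P, ∃ k : ℕ, ∀ x ∈ P, (α ^ p ^ k) x = x := by
  rw [isPGroup_iff_pow_pow_eq_one, (QuotientGroup.mk'_surjective _).forall, Subtype.forall]
  simp_rw [← map_pow, QuotientGroup.mk'_apply, QuotientGroup.eq_one_iff, mem_subgroupOf,
    mem_autC, coe_pow]

lemma innerFrobenius_of_autN_quotient {G : Type*} [Group G]
    (h : ∀ (p : ℕ), p.Prime → ∀ P : Subgroup G, IsPGroup p P →
        IsPGroup p (↥(autN P) ⧸ (autC P).subgroupOf (autN P))) : InnerFrobenius G := by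
  intro p hp P hP g hg
  obtain ⟨k, hk⟩ := isPGroup_autN_quotient_autC_iff.1 (h p hp P hP) (MulAut.conj g) (by
    rw [autN, MulAction.mem_stabilizer_iff]
    exact mem_normalizer_iff_map_conj_eq.1 hg)
  refine ⟨k, fun x hx ↦ ?_⟩
  have := hk x hx
  rwa [← map_pow, MulAut.conj_apply, mul_inv_eq_iff_eq_mul] at this

lemma mem_autoL_zero {G : Type*} [Group G] {x : G} : x ∈ autoL G 0 ↔ x = 1 := by
  simp [autoL]

lemma mem_autoL_succ {G : Type*} [Group G] {n : ℕ} {x : G} :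
    x ∈ autoL G (n + 1) ↔ ∀ α : MulAut G, autoComm x α ∈ autoL G n := by
  constructor
  · intro h α l hl
    exact h (α :: l) (by simp [hl])
  · rintro h (_ | ⟨α, l⟩) hl
    · simp at hl
    · exact h α l (by simpa using hl)

lemma exists_characteristic_eq_autoL (G : Type*) [Group G] (n : ℕ) :
    ∃ H : Subgroup G, H.Characteristic ∧ (H : Set G) = autoL G n := by
  induction n with
  | zero => exact ⟨⊥, inferInstance, by ext; simp [mem_autoL_zero]⟩
  | succ n ih =>
    obtain ⟨H, hH, hHn⟩ := ih
    have hmem (x : G) : x ∈ autoL G (n + 1) ↔ ∀ α : MulAut G, autoComm x α ∈ H := by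
      rw [mem_autoL_succ, ← hHn]; rfl
    have hmap (α : MulAut G) {x : G} (hx : x ∈ H) : α x ∈ H := by
      rw [← characteristic_iff_comap_eq.1 hH α] at hx; exact hx
    have hnormal : H.Normal := inferInstance
    refine ⟨{ carrier := autoL G (n + 1), mul_mem' := ?_, one_mem' := ?_, inv_mem' := ?_ }, ?_, rfl⟩
    · intro x y hx hy
      rw [hmem] at *
      intro α
      have : autoComm (x * y) α = y⁻¹ * autoComm x α * y * autoComm y α := by
        simp [autoComm, mul_assoc]
      rw [this]
      exact mul_mem (by simpa using hnormal.conj_mem _ (hx α) y⁻¹) (hy α)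
    · rw [hmem]
      simp [autoComm]
    · intro x hx
      rw [hmem] at *
      intro α
      have : autoComm x⁻¹ α = x * (autoComm x α)⁻¹ * x⁻¹ := by simp [autoComm, mul_assoc]
      rw [this]
      exact hnormal.conj_mem _ (inv_mem (hx α)) x
    · rw [characteristic_iff_le_comap]
      intro α x hx
      change α x ∈ autoL G (n + 1)
      change x ∈ autoL G (n + 1) at hx
      rw [hmem] at *
      intro β
      have : autoComm (α x) β = α (autoComm x (α⁻¹ * β * α)) := by
        simp [autoComm, MulAut.mul_apply]
      rw [this]
      exact hmap α (hx _)

lemma autoL_mono (G : Type*) [Group G] : Monotone (autoL G) := by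
  refine monotone_nat_of_le_succ fun n x hx ↦ ?_
  obtain ⟨H, hH, hHn⟩ := exists_characteristic_eq_autoL G n
  rw [mem_autoL_succ]
  intro α
  rw [← hHn] at hx ⊢
  refine mul_mem (inv_mem hx) ?_
  rw [← characteristic_iff_comap_eq.1 hH α] at hx; exact hx

open scoped commutatorElement in
/-- If `Aut G` induces a `p`-group on a characteristic `p`-subgroup, this subgroup lies in some
`Lₙ(G)`. -/
lemma exists_le_autoL_of_isPGroup {G : Type*} [Group G] [Finite G] {p : ℕ} [hp : Fact p.Prime]
    (P : Subgroup G) [P.Characteristic] (hP : IsPGroup p P)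
    (h : ∀ α : MulAut G, ∃ k : ℕ, ∀ x ∈ P, (α ^ p ^ k) x = x) :
    ∃ n, (P : Set G) ⊆ autoL G n := by
  let Γ := (MulAut.characteristic P).range
  have hΓ : IsPGroup p Γ := by
    rintro ⟨_, α, rfl⟩
    obtain ⟨k, hk⟩ := h α
    refine ⟨k, Subtype.ext ?_⟩
    simp only [coe_pow, coe_one, ← map_pow]
    ext x
    exact hk x x.2
  let K := P ⋊[Γ.subtype] Γ
  have : Finite K := Finite.of_equiv _ SemidirectProduct.equivProd.symm
  have hK : IsPGroup p K := by
    obtain ⟨a, ha⟩ := IsPGroup.iff_card.1 hP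
    obtain ⟨b, hb⟩ := IsPGroup.iff_card.1 hΓ
    exact IsPGroup.of_card (n := a + b) (by rw [SemidirectProduct.card, ha, hb, pow_add])
  have hnil : Group.IsNilpotent K := hK.isNilpotent
  obtain ⟨n, hn⟩ := Subgroup.nilpotent_iff_lowerCentralSeries.1 hnil
  refine ⟨n, fun x hx ↦ ?_⟩
  have key (m : ℕ) (x : P)
      (hx : (SemidirectProduct.inl x : K) ∈ (⊤ : Subgroup K).lowerCentralSeries (n - m))
      (hm : m ≤ n) : (x : G) ∈ autoL G m := by
    induction m generalizing x with
    | zero =>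
      rw [Nat.sub_zero, hn, mem_bot, ← map_one (SemidirectProduct.inl : P →* K),
        SemidirectProduct.inl_inj] at hx
      rw [mem_autoL_zero, hx, coe_one]
    | succ m ih =>
      rw [mem_autoL_succ]
      intro α
      let γ : Γ := ⟨_, α, rfl⟩
      have hγ : autoComm (x : G) α = (x⁻¹ * (γ : MulAut P) x : P) := rfl
      rw [hγ]
      refine ih _ ?_ (by omega)
      rw [show n - m = n - (m + 1) + 1 by omega]
      have hc : (SemidirectProduct.inl (x⁻¹ * (γ : MulAut P) x) : K) =
          ⁅(SemidirectProduct.inl x⁻¹ : K), (SemidirectProduct.inr γ : K)⁆ := by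
        rw [commutatorElement_def, map_mul]
        have := SemidirectProduct.inl_aut (φ := Γ.subtype) γ x
        simp only [Subgroup.coe_subtype] at this
        rw [this]
        simp [mul_assoc]
      rw [hc]
      rw [Subgroup.lowerCentralSeries_succ]
      exact commutator_mem_commutator (by rw [map_inv]; exact inv_mem hx) (mem_top _)
  exact key n ⟨x, hx⟩ (by simp) le_rfl

theorem autonilpotent_of_isNilpotent {G : Type*} [Group G] [Finite G] [Group.IsNilpotent G]
    (h : ∀ (p : ℕ), p.Prime → ∀ P : Subgroup G, IsPGroup p P →
        IsPGroup p (↥(autN P) ⧸ (autC P).subgroupOf (autN P))) : Autonilpotent G := by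
  have hsyl (p : ℕ) : ∃ n, p.Prime → ∃ P : Sylow p G, ((P : Subgroup G) : Set G) ⊆ autoL G n := by
    by_cases hp : p.Prime
    swap
    · exact ⟨0, fun h ↦ absurd h hp⟩
    have := Fact.mk hp
    obtain ⟨P⟩ : Nonempty (Sylow p G) := inferInstance
    have hc : (P : Subgroup G).Characteristic := P.characteristic_of_normal inferInstance
    obtain ⟨n, hn⟩ := exists_le_autoL_of_isPGroup (P : Subgroup G) P.isPGroup' fun α ↦
      isPGroup_autN_quotient_autC_iff.1 (h p hp P P.isPGroup') α
        (MulAction.mem_stabilizer_iff.2 (characteristic_iff_map_eq.1 hc α))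
    exact ⟨n, fun _ ↦ ⟨P, hn⟩⟩
  choose n hn using hsyl
  let m := (Nat.card G).primeFactors.sup n
  obtain ⟨H, -, hH⟩ := exists_characteristic_eq_autoL G m
  refine ⟨m, fun x ↦ ?_⟩
  suffices H = ⊤ by
    rw [← hH, this]; trivial
  rw [← index_eq_one, Nat.eq_one_iff_not_exists_prime_dvd]
  intro p hp hdvd
  have := Fact.mk hp
  obtain ⟨P, hP⟩ := hn p hp
  have hpm : n p ≤ m := Finset.le_sup
    (Nat.mem_primeFactors.2 ⟨hp, hdvd.trans H.index_dvd_card, Nat.card_pos.ne'⟩)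
  have hPH : (P : Subgroup G) ≤ H := fun y hy ↦ by
    rw [← SetLike.mem_coe, hH]
    exact autoL_mono G hpm (hP hy)
  exact P.not_dvd_index (hdvd.trans (index_dvd_of_le hPH))

/-- An automorphism acting on a `p`-subgroup `P` with order prime to `p` fixes every element of
`P` that lies in some `Lₙ(G)`. -/
lemma apply_eq_self_of_mem_autoL {G : Type*} [Group G] {p m n : ℕ} {P : Subgroup G}
    (hP : IsPGroup p P) {γ : MulAut G} (hγ : γ ∈ autN P) (hm : p.Coprime m)
    (hγm : ∀ x ∈ P, (γ ^ m) x = x) {x : G} (hx : x ∈ P) (hxn : x ∈ autoL G n) : γ x = x := by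
  have hγP {y : G} (hy : y ∈ P) : γ y ∈ P := by
    rw [← (MulAction.mem_stabilizer_iff.1 hγ)]
    exact smul_mem_pointwise_smul y γ P hy
  induction n generalizing x with
  | zero => rw [mem_autoL_zero.1 hxn, map_one]
  | succ n ih =>
    have hyP : autoComm x γ ∈ P := mul_mem (inv_mem hx) (hγP hx)
    have hy := ih hyP (mem_autoL_succ.1 hxn γ)
    have hγx : γ x = x * autoComm x γ := by simp [autoComm]
    set y := autoComm x γ
    have hpow (j : ℕ) : (γ ^ j) x = x * y ^ j := by
      induction j with
      | zero => simp
      | succ j ihj => rw [pow_succ', MulAut.mul_apply, ihj, map_mul, map_pow, hy, hγx, pow_succ',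
          mul_assoc]
    have hym : y ^ m = 1 := by simpa [hγm x hx] using hpow m
    have : (⟨y, hyP⟩ : P) = 1 := (hP.powEquiv hm).injective (Subtype.ext (by simpa using hym))
    have hy1 : y = 1 := congrArg Subtype.val this
    rw [hγx, hy1, mul_one]

/-- A finite group `G` is autonilpotent iff `N_{Aut G}(P)/C_{Aut G}(P)` is a `p`-group for
every `p`-subgroup `P` of `G` and every prime `p`. -/
theorem autonilpotent_iff_frobenius_condition (G : Type*) [Group G] [Finite G] :
    Autonilpotent G ↔
      ∀ (p : ℕ), p.Prime → ∀ P : Subgroup G, IsPGroup p P →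
        IsPGroup p (↥(autN P) ⧸ (autC P).subgroupOf (autN P)) := by
  refine ⟨?_, fun h ↦ ?_⟩
  · rintro ⟨n, hn⟩ p hp P hP
    rw [isPGroup_autN_quotient_autC_iff]
    intro α hα
    obtain ⟨k, m, hpm, hkm⟩ :=
      Nat.exists_eq_pow_mul_and_not_dvd (orderOf_pos α).ne' p hp.ne_one
    refine ⟨k, fun x hx ↦ apply_eq_self_of_mem_autoL hP (pow_mem hα _)
      ((Nat.Prime.coprime_iff_not_dvd hp).2 hpm) (fun y _ ↦ ?_) hx (hn x)⟩
    rw [← pow_mul, ← hkm, pow_orderOf_eq_one, MulAut.one_apply]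
  · have := (innerFrobenius_of_autN_quotient h).isNilpotent
    exact autonilpotent_of_isNilpotent h
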